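/- arXiv:2411.19175 — 2 statements merged into one kernel-verified Lean document; each statement's English description precedes it below -/
import Mathlib

section
/- For every p₀ with 0 < p₀ ≤ 1/2, one has √(2²⁵·(ln(2(1 − p₀)) − ln p₀)) > 4685. -/
theorem finalization_after_ejection (p₀ : ℝ) (h0 : 0 < p₀) (h : p₀ ≤ 1 / 2) :
    Real.sqrt (2 ^ 25 * (Real.log (2 * (1 - p₀)) - Real.log p₀)) > 4685 := by
  have h_nonneg : 0 ≤ Real.log (2 * (1 - p₀)) := Real.log_nonneg (by linarith)
  have h_le : Real.log p₀ ≤ -Real.log 2 := by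
    rw [← Real.log_inv]
    exact Real.log_le_log h0 (by linarith)
  have h_two := Real.log_two_gt_d9
  refine Real.lt_sqrt_of_sq_lt ?_
  norm_num at h_two ⊢
  linarith
end

section
/- Fix β₀ ∈ (0, 1/3) and p₀ ∈ (0, 1) satisfying p₀ + β₀/(1 − β₀) < min(2(1 − p₀), 2/3), and let t* = √(2²⁵·(ln(2(1 − p₀)) − ln(p₀ + β₀/(1 − β₀)))). Then for t ≥ 0 the equation (p₀(1 − β₀) + β₀) / (p₀(1 − β₀) + β₀ + (1 − p₀)(1 − β₀)·exp(−t²/2²⁵)) = 2/3 holds if and only if t = t*. -/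
theorem byzantine_finalization_time (β₀ p₀ : ℝ)
    (hβ₀ : β₀ ∈ Set.Ioo (0 : ℝ) (1 / 3)) (hp₀ : p₀ ∈ Set.Ioo (0 : ℝ) 1)
    (h : p₀ + β₀ / (1 - β₀) < min (2 * (1 - p₀)) (2 / 3)) :
    ∀ t : ℝ, 0 ≤ t →
      ((p₀ * (1 - β₀) + β₀) /
          (p₀ * (1 - β₀) + β₀ + (1 - p₀) * (1 - β₀) * Real.exp (-t ^ 2 / 2 ^ 25)) = 2 / 3 ↔
        t = Real.sqrt (2 ^ 25 *
          (Real.log (2 * (1 - p₀)) - Real.log (p₀ + β₀ / (1 - β₀))))) := by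
  intro t ht
  obtain ⟨hβ, hβ'⟩ := hβ₀
  obtain ⟨hp, hp'⟩ := hp₀
  have hB : 0 < 1 - β₀ := by linarith
  have hq : 0 < 1 - p₀ := by linarith
  have hnum : p₀ * (1 - β₀) + β₀ = (p₀ + β₀ / (1 - β₀)) * (1 - β₀) := by
    field_simp
  have ha : 0 < p₀ + β₀ / (1 - β₀) := by positivity
  have hlt := h.trans_le (min_le_left _ _)
  rw [hnum]
  generalize p₀ + β₀ / (1 - β₀) = a at *
  have hlog : Real.log a < Real.log (2 * (1 - p₀)) := Real.log_lt_log ha hlt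
  have hE := Real.exp_pos (-t ^ 2 / 2 ^ 25)
  have hratio : a * (1 - β₀) / (a * (1 - β₀) + (1 - p₀) * (1 - β₀) *
      Real.exp (-t ^ 2 / 2 ^ 25)) = 2 / 3 ↔
      a = 2 * (1 - p₀) * Real.exp (-t ^ 2 / 2 ^ 25) := by
    rw [div_eq_div_iff (by positivity) (by norm_num)]
    constructor
    · intro heq
      apply mul_right_cancel₀ hB.ne'
      linarith
    · intro heq
      linear_combination (1 - β₀) * heq
  have hexp : a = 2 * (1 - p₀) * Real.exp (-t ^ 2 / 2 ^ 25) ↔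
      Real.log a = Real.log (2 * (1 - p₀)) + -t ^ 2 / 2 ^ 25 := by
    rw [← Real.log_exp (-t ^ 2 / 2 ^ 25), ← Real.log_mul (by positivity) hE.ne', Real.log_exp]
    exact (Real.log_injOn_pos.eq_iff ha (Set.mem_Ioi.mpr (by positivity))).symm
  rw [hratio, hexp, eq_comm (a := t), Real.sqrt_eq_iff_eq_sq (by linarith) ht]
  constructor <;> intro heq <;> linarith
end
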